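/- arXiv:1402.4698 — 2 statements merged into one kernel-verified Lean document; each statement's English description precedes it below -/
import Mathlib

section
/- Let T > 0, let f : [0,T] → ℝ be continuous with modulus of continuity ω_f(ε) = sup{ |f(u) − f(v)| : u,v ∈ [0,T], |u − v| ≤ ε }. Let γ > 0 and let P be a countable family of points (τ,y) ∈ [0,T] × (0,∞) such that only finitely many points of P have y > γ, and let B = {(τ,y) ∈ P : y > γ}. Let 0 = s_0 < s_1 < … < s_m = T be a partition with mesh |α| = max_{0 ≤ j ≤ m−1}(s_{j+1} − s_j), and assume that for each j = 0,…,m−1 the open interval (s_j, s_{j+1}) contains the time coordinate of at least one point of B. Then for every t ∈ [0,T], |F(f,P)(t) − F(f,B)(t)| ≤ ω_f(3|α|) + γ. -/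
open Set Filter Topology
open scoped Classical

/-- `FF f P t` is the running maximum `sup { f τ + y : (τ,y) ∈ P, τ ≤ t }`,
with the convention that it equals `f 0` when `P` has no point with time coordinate `≤ t`. -/
noncomputable def FF (f : ℝ → ℝ) (P : Set (ℝ × ℝ)) (t : ℝ) : ℝ :=
  if ∃ p ∈ P, p.1 ≤ t then sSup ((fun p : ℝ × ℝ => f p.1 + p.2) '' {p ∈ P | p.1 ≤ t})
  else f 0

/-- Modulus of continuity of `f` on `[0,T]` at scale `ε`. -/
noncomputable def modCont (f : ℝ → ℝ) (T ε : ℝ) : ℝ :=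
  sSup {d : ℝ | ∃ u ∈ Icc (0 : ℝ) T, ∃ v ∈ Icc (0 : ℝ) T, |u - v| ≤ ε ∧ d = |f u - f v|}

/-- Inequality (2)/(3) from the proof of Theorem 2: keeping only the points with
second coordinate `> γ` changes the running maximum by at most `ω_f(3|α|) + γ`,
provided every partition interval contains a big point. -/
theorem abs_FF_sub_FF_big_le
    (T : ℝ) (hT : 0 < T)
    (f : ℝ → ℝ) (hf : ContinuousOn f (Icc 0 T))
    (γ : ℝ) (hγ : 0 < γ)
    (P : Set (ℝ × ℝ)) (hPc : P.Countable)
    (hPsub : ∀ p ∈ P, p.1 ∈ Icc 0 T ∧ 0 < p.2)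
    (hPfin : {p ∈ P | γ < p.2}.Finite)
    (m : ℕ) (hm : 0 < m)
    (s : ℕ → ℝ) (hs0 : s 0 = 0) (hsm : s m = T)
    (hmono : ∀ j < m, s j < s (j + 1))
    (α : ℝ) (hα : ∀ j < m, s (j + 1) - s j ≤ α)
    (hbig : ∀ j < m, ∃ p ∈ P, γ < p.2 ∧ p.1 ∈ Ioo (s j) (s (j + 1))) :
    ∀ t ∈ Icc (0 : ℝ) T,
      |FF f P t - FF f {p ∈ P | γ < p.2} t| ≤ modCont f T (3 * α) + γ := by
  intro t ht
  obtain ⟨M, hM⟩ : ∃ M, ∀ u ∈ Icc (0 : ℝ) T, |f u| ≤ M := by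
    obtain ⟨M, hM⟩ := isCompact_Icc.exists_bound_of_continuousOn hf
    exact ⟨M, fun u hu => by simpa using hM u hu⟩
  have hW : ∀ u ∈ Icc (0 : ℝ) T, ∀ v ∈ Icc (0 : ℝ) T, |u - v| ≤ 3 * α →
      |f u - f v| ≤ modCont f T (3 * α) := by
    intro u hu v hv huv
    apply le_csSup
    · refine ⟨M + M, ?_⟩
      rintro d ⟨a, ha, b, hb, -, rfl⟩
      have h1 := abs_le.1 (hM a ha)
      have h2 := abs_le.1 (hM b hb)
      rw [abs_le]
      constructor <;> linarith
    · exact ⟨u, hu, v, hv, huv, rfl⟩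
  have hα0 : s 1 ≤ α := by
    have := hα 0 hm
    rw [hs0] at this
    simpa using this
  have hs1 : 0 < s 1 := by
    have := hmono 0 hm
    rwa [hs0] at this
  have h0T : (0 : ℝ) ∈ Icc (0 : ℝ) T := ⟨le_rfl, hT.le⟩
  have hWnn : 0 ≤ modCont f T (3 * α) := by
    have := hW 0 h0T 0 h0T (by simp; linarith)
    simpa using this
  obtain ⟨q1, hq1P, hq1γ, hq1l, hq1u⟩ := hbig 0 hm
  rw [hs0] at hq1l
  simp only [zero_add] at hq1u
  by_cases hP : ∃ p ∈ P, p.1 ≤ t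
  swap
  · have hB : ¬ ∃ p ∈ {p ∈ P | γ < p.2}, p.1 ≤ t := by
      rintro ⟨p, hp, hpt⟩
      exact hP ⟨p, hp.1, hpt⟩
    unfold FF
    rw [if_neg hP, if_neg hB]
    simp
    linarith
  obtain ⟨N, hN⟩ := (hPfin.image (fun p : ℝ × ℝ => p.2)).bddAbove
  have hbdd : BddAbove ((fun p : ℝ × ℝ => f p.1 + p.2) '' {p ∈ P | p.1 ≤ t}) := by
    refine ⟨M + max N γ, ?_⟩
    rintro _ ⟨p, ⟨hp, -⟩, rfl⟩
    have h1 := (abs_le.1 (hM p.1 (hPsub p hp).1)).2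
    have h2 : p.2 ≤ max N γ := by
      by_cases h : γ < p.2
      · exact le_max_of_le_left (hN ⟨p, ⟨hp, h⟩, rfl⟩)
      · exact le_max_of_le_right (not_lt.1 h)
    exact add_le_add h1 h2
  by_cases hB : ∃ p ∈ {p ∈ P | γ < p.2}, p.1 ≤ t
  swap
  · unfold FF
    rw [if_pos hP, if_neg hB]
    have htq : t < q1.1 := by
      by_contra h
      exact hB ⟨q1, ⟨hq1P, hq1γ⟩, not_lt.1 h⟩
    have key : ∀ p ∈ P, p.1 ≤ t → |f p.1 - f 0| ≤ modCont f T (3 * α) := by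
      intro p hp hpt
      have h := (hPsub p hp).1
      apply hW _ h _ h0T
      rw [sub_zero, abs_of_nonneg h.1]
      linarith
    rw [abs_le]
    constructor
    · obtain ⟨p, hp, hpt⟩ := hP
      have h1 := le_csSup hbdd ⟨p, ⟨hp, hpt⟩, rfl⟩
      have h2 := (abs_le.1 (key p hp hpt)).1
      have h3 := (hPsub p hp).2
      simp only at h1
      linarith
    · rw [sub_le_iff_le_add]
      apply csSup_le
      · obtain ⟨p, hp, hpt⟩ := hP
        exact ⟨_, p, ⟨hp, hpt⟩, rfl⟩
      · rintro _ ⟨p, ⟨hp, hpt⟩, rfl⟩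
        have h2 := (abs_le.1 (key p hp hpt)).2
        have h3 : p.2 ≤ γ := by
          by_contra h
          exact hB ⟨p, ⟨hp, not_le.1 h⟩, hpt⟩
        simp only
        linarith
  have hsub : ((fun p : ℝ × ℝ => f p.1 + p.2) '' {p ∈ {p ∈ P | γ < p.2} | p.1 ≤ t}) ⊆
      ((fun p : ℝ × ℝ => f p.1 + p.2) '' {p ∈ P | p.1 ≤ t}) := by
    rintro _ ⟨p, ⟨hp, hpt⟩, rfl⟩
    exact ⟨p, ⟨hp.1, hpt⟩, rfl⟩
  have hbddB := hbdd.mono hsub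
  have claim0 : ∃ q ∈ P, γ < q.2 ∧ q.1 ≤ t ∧ q.1 ≤ α := by
    obtain ⟨q, hq, hqt⟩ := hB
    by_cases h : q.1 ≤ α
    · exact ⟨q, hq.1, hq.2, hqt, h⟩
    · exact ⟨q1, hq1P, hq1γ, by linarith, by linarith⟩
  have claim : ∀ n ≤ m, ∀ τ, 0 ≤ τ → τ ≤ t → τ ≤ s n →
      ∃ q ∈ P, γ < q.2 ∧ q.1 ≤ t ∧ |τ - q.1| ≤ 3 * α := by
    have base : ∀ τ, 0 ≤ τ → τ ≤ s 1 → ∃ q ∈ P, γ < q.2 ∧ q.1 ≤ t ∧ |τ - q.1| ≤ 3 * α := by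
      intro τ h0 h1
      obtain ⟨q, hq, hqγ, hqt, hqα⟩ := claim0
      have := (hPsub q hq).1.1
      exact ⟨q, hq, hqγ, hqt, by rw [abs_le]; constructor <;> linarith⟩
    intro n
    induction n with
    | zero =>
      intro _ τ h0 _ h1
      exact base τ h0 (by linarith)
    | succ n ih =>
      intro hn τ h0 hτt h1
      by_cases h : τ ≤ s n
      · exact ih (by omega) τ h0 hτt h
      · cases n with
        | zero => exact base τ h0 h1
        | succ k =>
          obtain ⟨q, hq, hqγ, hql, hqu⟩ := hbig k (by omega)
          have e1 := hα k (by omega)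
          have e2 := hα (k + 1) (by omega)
          push Not at h
          exact ⟨q, hq, hqγ, by linarith, by rw [abs_le]; constructor <;> linarith⟩
  unfold FF
  rw [if_pos hP, if_pos hB]
  have hle : sSup ((fun p : ℝ × ℝ => f p.1 + p.2) '' {p ∈ {p ∈ P | γ < p.2} | p.1 ≤ t}) ≤
      sSup ((fun p : ℝ × ℝ => f p.1 + p.2) '' {p ∈ P | p.1 ≤ t}) := by
    apply csSup_le_csSup hbdd _ hsub
    obtain ⟨p, hp, hpt⟩ := hB
    exact ⟨_, p, ⟨hp, hpt⟩, rfl⟩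
  rw [abs_of_nonneg (sub_nonneg.2 hle), sub_le_iff_le_add]
  apply csSup_le
  · obtain ⟨p, hp, hpt⟩ := hP
    exact ⟨_, p, ⟨hp, hpt⟩, rfl⟩
  · rintro _ ⟨p, ⟨hp, hpt⟩, rfl⟩
    simp only
    by_cases h : γ < p.2
    · have h1 := le_csSup hbddB ⟨p, ⟨⟨hp, h⟩, hpt⟩, rfl⟩
      simp only at h1
      linarith
    · have hpT := (hPsub p hp).1
      obtain ⟨q, hq, hqγ, hqt, hd⟩ := claim m le_rfl p.1 hpT.1 hpt (by rw [hsm]; exact hpT.2)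
      have h1 := le_csSup hbddB ⟨q, ⟨⟨hq, hqγ⟩, hqt⟩, rfl⟩
      have h2 := (abs_le.1 (hW _ hpT _ (hPsub q hq).1 hd)).2
      simp only at h1
      linarith
end

section
/- Let T > 0 and let f : [0,T] → ℝ be continuous. Let P be a countable family of points (τ,y) with τ ∈ (0,T), y ∈ (0,∞), such that for every γ > 0 only finitely many points of P have y > γ, and for all 0 ≤ a < b ≤ T there is a point of P with τ ∈ (a,b). Set G = F(f,P). Then: (i) G is real-valued and G(0) = f(0); (ii) G is nondecreasing on (0,T]; (iii) G(t) ≥ f(t) for every t ∈ (0,T]; (iv) G is right-continuous on [0,T) and has finite left limits on (0,T]; (v) lim_{t ↓ 0} G(t) = f(0); and (vi) G is continuous at every t ∈ (0,T] that is not the time coordinate of any point of P. -/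
open Set Filter Topology
open scoped Classical

/-- Regularity of `G = F(f, P)` asserted in Theorem 2 and its footnote:
`G(0) = f(0)`, `G` is nondecreasing on `(0,T]`, dominates `f` there, is right-continuous
with finite left limits, tends to `f(0)` as `t ↓ 0`, and is continuous at every time
carrying no atom of `P`. -/
theorem regularity_of_running_max
    (T : ℝ) (hT : 0 < T)
    (f : ℝ → ℝ) (hf : ContinuousOn f (Icc 0 T))
    (P : Set (ℝ × ℝ)) (hPc : P.Countable)
    (hPsub : ∀ p ∈ P, p.1 ∈ Ioo 0 T ∧ 0 < p.2)
    (hPfin : ∀ γ > (0 : ℝ), {p ∈ P | γ < p.2}.Finite)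
    (hPdense : ∀ a b : ℝ, 0 ≤ a → a < b → b ≤ T → ∃ p ∈ P, p.1 ∈ Ioo a b) :
    FF f P 0 = f 0 ∧
    MonotoneOn (FF f P) (Ioc 0 T) ∧
    (∀ t ∈ Ioc (0 : ℝ) T, f t ≤ FF f P t) ∧
    (∀ t ∈ Ico (0 : ℝ) T, Tendsto (FF f P) (𝓝[>] t) (𝓝 (FF f P t))) ∧
    (∀ t ∈ Ioc (0 : ℝ) T, ∃ L : ℝ, Tendsto (FF f P) (𝓝[<] t) (𝓝 L)) ∧
    Tendsto (FF f P) (𝓝[>] (0 : ℝ)) (𝓝 (f 0)) ∧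
    (∀ t ∈ Ioc (0 : ℝ) T, (∀ p ∈ P, p.1 ≠ t) →
      ContinuousWithinAt (FF f P) (Icc 0 T) t) := by
  have hex : ∀ t : ℝ, 0 < t → ∃ p ∈ P, p.1 ≤ t := by
    intro t ht
    obtain ⟨p, hp, hp1⟩ := hPdense 0 (min t T) le_rfl (lt_min ht hT) (min_le_right _ _)
    exact ⟨p, hp, hp1.2.le.trans (min_le_left _ _)⟩
  have hbdd : ∀ t : ℝ, BddAbove ((fun p : ℝ × ℝ => f p.1 + p.2) '' {p ∈ P | p.1 ≤ t}) := by
    intro t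
    obtain ⟨M, hM⟩ := (isCompact_Icc.image_of_continuousOn hf).bddAbove
    have hfin : BddAbove ((fun p : ℝ × ℝ => f p.1 + p.2) '' {p ∈ P | 1 < p.2}) :=
      ((hPfin 1 one_pos).image _).bddAbove
    obtain ⟨N, hN⟩ := hfin
    refine ⟨max N (M + 1), ?_⟩
    rintro _ ⟨p, ⟨hp, -⟩, rfl⟩
    by_cases h : 1 < p.2
    · exact (hN ⟨p, ⟨hp, h⟩, rfl⟩).trans (le_max_left _ _)
    · have h1 := (hPsub p hp).1
      have h2 : f p.1 ≤ M := hM ⟨p.1, ⟨h1.1.le, h1.2.le⟩, rfl⟩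
      refine le_trans ?_ (le_max_right _ _)
      show f p.1 + p.2 ≤ M + 1
      linarith
  have hle : ∀ t : ℝ, ∀ p ∈ P, p.1 ≤ t → f p.1 + p.2 ≤ FF f P t := by
    intro t p hp hpt
    unfold FF
    rw [if_pos ⟨p, hp, hpt⟩]
    exact le_csSup (hbdd t) ⟨p, ⟨hp, hpt⟩, rfl⟩
  have hub : ∀ t c : ℝ, 0 < t → (∀ p ∈ P, p.1 ≤ t → f p.1 + p.2 ≤ c) → FF f P t ≤ c := by
    intro t c ht h
    obtain ⟨q, hq, hqt⟩ := hex t ht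
    unfold FF
    rw [if_pos ⟨q, hq, hqt⟩]
    refine csSup_le ⟨_, q, ⟨hq, hqt⟩, rfl⟩ ?_
    rintro _ ⟨p, ⟨hp, hpt⟩, rfl⟩
    exact h p hp hpt
  have h0 : FF f P 0 = f 0 := by
    unfold FF
    rw [if_neg]
    rintro ⟨p, hp, hp0⟩
    exact absurd (hPsub p hp).1.1 (not_lt.2 hp0)
  have hmono : ∀ s t : ℝ, 0 < s → s ≤ t → FF f P s ≤ FF f P t := fun s t hs hst =>
    hub s _ hs fun p hp hps => hle t p hp (hps.trans hst)
  have hcont : ∀ t ∈ Icc (0 : ℝ) T, ∀ ε > 0, ∃ δ > 0, ∀ s ∈ Icc (0 : ℝ) T, |s - t| < δ →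
      |f s - f t| < ε := by
    intro t ht ε hε
    obtain ⟨δ, hδ, h⟩ := Metric.continuousOn_iff.1 hf t ht ε hε
    exact ⟨δ, hδ, fun s hs hst => h s hs hst⟩
  have hdom : ∀ t ∈ Ioc (0 : ℝ) T, f t ≤ FF f P t := by
    intro t ht
    refine le_of_forall_pos_le_add fun ε hε => ?_
    obtain ⟨δ, hδ, h⟩ := hcont t ⟨ht.1.le, ht.2⟩ ε hε
    obtain ⟨p, hp, hp1, hp2⟩ := hPdense (max 0 (t - δ)) t (le_max_left _ _)
      (max_lt ht.1 (by linarith)) ht.2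
    have h1 := (hPsub p hp)
    have h2 : t - δ < p.1 := (le_max_right _ _).trans_lt hp1
    have h3 := abs_lt.1 (h p.1 ⟨h1.1.1.le, h1.1.2.le⟩ (abs_lt.2 ⟨by linarith, by linarith⟩))
    have h4 := hle t p hp hp2.le
    linarith [h1.2]
  have hkey : ∀ t ∈ Icc (0 : ℝ) T, ∀ ε > 0, ∃ δ > 0,
      (∀ s ∈ Icc (0 : ℝ) T, |s - t| < δ → |f s - f t| < ε) ∧
      ∀ p ∈ P, p.1 ≠ t → |p.1 - t| < δ → f p.1 + p.2 < f t + ε := by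
    intro t ht ε hε
    obtain ⟨δ, hδ, h⟩ := hcont t ht (ε / 2) (half_pos hε)
    have hfin : (Prod.fst '' {p ∈ P | ε / 2 < p.2} \ {t}).Finite :=
      ((hPfin (ε / 2) (half_pos hε)).image _).sdiff
    have hmem : (Prod.fst '' {p ∈ P | ε / 2 < p.2} \ {t})ᶜ ∈ 𝓝 t :=
      hfin.isClosed.isOpen_compl.mem_nhds (fun hh => hh.2 rfl)
    obtain ⟨η, hη, hball⟩ := Metric.mem_nhds_iff.1 hmem
    refine ⟨min δ η, lt_min hδ hη, fun s hs hst => ?_, fun p hp hpt hd => ?_⟩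
    · exact (h s hs (hst.trans_le (min_le_left _ _))).trans (half_lt_self hε)
    · have h1 := (hPsub p hp).1
      have h2 := abs_lt.1 (h p.1 ⟨h1.1.le, h1.2.le⟩ (hd.trans_le (min_le_left _ _)))
      have h3 : p.1 ∈ Metric.ball t η := hd.trans_le (min_le_right _ _)
      have h4 : p.2 ≤ ε / 2 := by
        by_contra hc
        exact hball h3 ⟨⟨p, ⟨hp, not_le.1 hc⟩, rfl⟩, hpt⟩
      linarith
  have hzero : Tendsto (FF f P) (𝓝[>] (0 : ℝ)) (𝓝 (f 0)) := by
    rw [Metric.tendsto_nhdsWithin_nhds]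
    intro ε hε
    obtain ⟨δ, hδ, hc, hk⟩ := hkey 0 ⟨le_rfl, hT.le⟩ (ε / 2) (half_pos hε)
    refine ⟨min δ T, lt_min hδ hT, fun {s} hs hd => ?_⟩
    have hs0 : 0 < s := hs
    rw [Real.dist_eq, sub_zero, abs_of_pos hs0] at hd
    have hsδ := hd.trans_le (min_le_left _ _)
    have hsT := hd.trans_le (min_le_right _ _)
    have h1 := abs_lt.1 (hc s ⟨hs0.le, hsT.le⟩ (by rwa [sub_zero, abs_of_pos hs0]))
    have h2 := hdom s ⟨hs0, hsT.le⟩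
    have h3 : FF f P s ≤ f 0 + ε / 2 := hub s _ hs0 fun p hp hps => by
      have hp0 := (hPsub p hp).1.1
      exact (hk p hp hp0.ne' (by rw [sub_zero, abs_of_pos hp0]; linarith)).le
    rw [Real.dist_eq, abs_lt]
    constructor <;> linarith
  have hright : ∀ t ∈ Ioc (0 : ℝ) T, ∀ ε > 0, ∃ δ > 0, ∀ s, t ≤ s → s < t + δ →
      FF f P s ≤ FF f P t + ε := by
    intro t ht ε hε
    obtain ⟨δ, hδ, hc, hk⟩ := hkey t ⟨ht.1.le, ht.2⟩ ε hε
    refine ⟨δ, hδ, fun s hts hs => hub s _ (ht.1.trans_le hts) fun p hp hps => ?_⟩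
    rcases le_or_gt p.1 t with h | h
    · linarith [hle t p hp h]
    · have := hk p hp h.ne' (by rw [abs_lt]; constructor <;> linarith)
      linarith [hdom t ht]
  refine ⟨h0, fun s hs t _ hst => hmono s t hs.1 hst, hdom, ?_, ?_, hzero, ?_⟩
  · intro t ht
    rcases ht.1.eq_or_lt with rfl | ht0
    · rw [h0]; exact hzero
    · rw [Metric.tendsto_nhdsWithin_nhds]
      intro ε hε
      obtain ⟨δ, hδ, h⟩ := hright t ⟨ht0, ht.2.le⟩ (ε / 2) (half_pos hε)
      refine ⟨δ, hδ, fun {s} hs hd => ?_⟩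
      have hs0 : t < s := hs
      rw [Real.dist_eq, abs_lt] at hd
      have h1 := h s hs0.le (by linarith)
      have h2 := hmono t s ht0 hs0.le
      rw [Real.dist_eq, abs_lt]
      constructor <;> linarith
  · intro t ht
    refine ⟨_, MonotoneOn.tendsto_nhdsWithin_Ioo_left (y := 0) (nonempty_Ioo.2 ht.1)
      (fun s hs u _ hsu => hmono s u hs.1 hsu) ⟨FF f P t, ?_⟩⟩
    rintro _ ⟨s, hs, rfl⟩
    exact hmono s t hs.1 hs.2.le
  · intro t ht hna
    rw [Metric.continuousWithinAt_iff]
    intro ε hε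
    obtain ⟨δ, hδ, hr⟩ := hright t ht (ε / 2) (half_pos hε)
    obtain ⟨η, hη, hc, hk⟩ := hkey t ⟨ht.1.le, ht.2⟩ (ε / 4) (by positivity)
    refine ⟨min (min δ η) t, lt_min (lt_min hδ hη) ht.1, fun {s} hs hd => ?_⟩
    rw [Real.dist_eq, lt_min_iff, lt_min_iff] at hd
    obtain ⟨⟨hd1, hd2⟩, hd3⟩ := hd
    have e1 := abs_lt.1 hd1
    have e2 := abs_lt.1 hd2
    have e3 := abs_lt.1 hd3
    have hs0 : 0 < s := by linarith
    rw [Real.dist_eq, abs_lt]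
    rcases le_total t s with hts | hst
    · have h1 := hr s hts (by linarith)
      have h2 := hmono t s ht.1 hts
      constructor <;> linarith
    · have h2 := hmono s t hs0 hst
      have h3 := abs_lt.1 (hc s hs hd2)
      have h4 := hdom s ⟨hs0, hs.2⟩
      have h1 : FF f P t ≤ FF f P s + ε / 2 := hub t _ ht.1 fun p hp hpt => by
        rcases le_or_gt p.1 s with h | h
        · linarith [hle s p hp h]
        · have := hk p hp (hna p hp) (by rw [abs_lt]; constructor <;> linarith)
          linarith
      constructor <;> linarith
end
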